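/- arXiv:2510.17630 — 3 statements merged into one kernel-verified Lean document; each statement's English description precedes it below -/
import Mathlib

section
/- Let B be the graph consisting of two disjoint copies A_1, A_2 of the Tutte–Coxeter graph (vertices a_1,...,a_30 and b_1,...,b_30) together with one new vertex c adjacent exactly to a_1 and b_1. Then B is bipartite of girth at least 8, and every graph embedding of the Tutte–Coxeter graph into B has image A_1 or A_2. -/
/-- The list of base edges of the Tutte–Coxeter graph on vertices `1, ..., 30`:
the 30-cycle together with the fifteen chords. -/
def tutteCoxeterPairs : List (ℕ × ℕ) :=
  [(1,2),(2,3),(3,4),(4,5),(5,6),(6,7),(7,8),(8,9),(9,10),(10,11),(11,12),(12,13),(13,14),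
   (14,15),(15,16),(16,17),(17,18),(18,19),(19,20),(20,21),(21,22),(22,23),(23,24),(24,25),
   (25,26),(26,27),(27,28),(28,29),(29,30),(30,1),
   (1,18),(2,23),(3,10),(4,27),(5,14),(6,19),(7,24),(8,29),(9,16),(11,20),(12,25),(13,30),
   (15,22),(17,26),(21,28)]

/-- The Tutte–Coxeter graph, on vertex set `Fin 30`, where the vertex `i : Fin 30`
represents the vertex `a_{i+1}` of the paper. -/
def tutteCoxeter : SimpleGraph (Fin 30) :=
  SimpleGraph.fromRel (fun i j => (i.val + 1, j.val + 1) ∈ tutteCoxeterPairs)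

instance : DecidableRel tutteCoxeter.Adj := fun a b =>
  decidable_of_iff _ (SimpleGraph.fromRel_adj _ a b).symm

/-- The graph `B`: two disjoint copies of the Tutte–Coxeter graph (`a_i`, represented by
the vertices `0, ..., 29`, and `b_i`, represented by `30, ..., 59`) together with one new
vertex `c` (vertex `60`) adjacent exactly to `a₁` and `b₁`. -/
def tutteCoxeterDoublePairs : List (ℕ × ℕ) :=
  (tutteCoxeterPairs.map (fun q => (q.1 - 1, q.2 - 1))) ++
  (tutteCoxeterPairs.map (fun q => (q.1 + 29, q.2 + 29))) ++
  [(60, 0), (60, 30)]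

def tutteCoxeterDouble : SimpleGraph (Fin 61) :=
  SimpleGraph.fromRel (fun i j => (i.val, j.val) ∈ tutteCoxeterDoublePairs)

/-- The sorting of the vertices of `B` into points (`true`) and lines (`false`): in each
copy of the Tutte–Coxeter graph the even-indexed vertices are points and the odd-indexed
ones are lines; `c` is a point. -/
def tutteCoxeterDoubleSort : Fin 61 → Bool := fun v =>
  if v.val = 60 then true else decide (v.val % 2 = 1)

/-- Starting a non-backtracking walk with the step from `prev` to `cur`, the vertex `target` is
not met within the next `k` steps; `nbr` lists the neighbours of each vertex. -/
def avoidsTarget (nbr : ℕ → List ℕ) (target : ℕ) : ℕ → ℕ → ℕ → Bool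
  | 0, _, _ => true
  | k + 1, prev, cur =>
    (nbr cur).all fun x => x == prev || (x != target && avoidsTarget nbr target k cur x)

/-- If `avoidsTarget` holds, a trail that ends in the target is long. -/
theorem lt_length_of_avoidsTarget {n : ℕ} {G : SimpleGraph (Fin n)} {nbr : ℕ → List ℕ}
    (hnbr : ∀ u v, G.Adj u v → v.val ∈ nbr u.val) {target cur : Fin n} (p : G.Walk cur target) :
    ∀ {prev : Fin n} (h : G.Adj prev cur) (k : ℕ), (SimpleGraph.Walk.cons h p).IsTrail →
      cur ≠ target → avoidsTarget nbr target.val k prev.val cur.val = true → k < p.length := by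
  induction p with
  | nil => intro _ _ _ _ hne; exact absurd rfl hne
  | @cons cur next target h' q ih =>
    intro prev h k htrail hne hk
    cases k with
    | zero => simp
    | succ k =>
      rw [SimpleGraph.Walk.isTrail_cons] at htrail
      have hback : next ≠ prev := by
        rintro rfl
        exact htrail.2 (by simp [Sym2.eq_swap])
      rw [avoidsTarget, List.all_eq_true] at hk
      have hnext := hk next.val (hnbr _ _ h')
      simp only [Bool.or_eq_true, beq_iff_eq, Bool.and_eq_true, bne_iff_ne] at hnext
      rcases hnext with hnext | ⟨hnext, hrec⟩
      · exact absurd (Fin.ext hnext) hback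
      · have := ih h' k htrail.1 (fun he => hnext (congrArg Fin.val he)) hrec
        simpa using this

/-- A lower bound for the girth, from the non-backtracking walks starting at each vertex. -/
theorem le_egirth_of_avoidsTarget {n : ℕ} {G : SimpleGraph (Fin n)} {nbr : ℕ → List ℕ}
    (hnbr : ∀ u v, G.Adj u v → v.val ∈ nbr u.val) (k : ℕ)
    (hk : ∀ u < n, ∀ v ∈ nbr u, avoidsTarget nbr u k u v = true) :
    ((k + 2 : ℕ) : ℕ∞) ≤ G.egirth := by
  rw [SimpleGraph.le_egirth]
  intro a w hw
  cases w with
  | nil => exact absurd rfl hw.ne_nil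
  | cons h p =>
    have := lt_length_of_avoidsTarget hnbr p h k hw.isTrail h.ne'
      (hk _ a.isLt _ (hnbr _ _ h))
    rw [SimpleGraph.Walk.length_cons]
    exact_mod_cast Nat.succ_le_succ this

/-- The neighbours of a vertex of the Tutte–Coxeter graph, with vertices numbered from `0`. -/
def tutteCoxeterNbr (i : ℕ) : List ℕ :=
  [(i + 1) % 30, (i + 29) % 30, (i + [17, 21, 7, 23, 9, 13].getD (i % 6) 0) % 30]

/-- The neighbours of a vertex of the double of the Tutte–Coxeter graph. -/
def tutteCoxeterDoubleNbr (i : ℕ) : List ℕ :=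
  if i = 60 then [0, 30]
  else (if i % 30 = 0 then [60] else []) ++
    (if i < 30 then tutteCoxeterNbr i else (tutteCoxeterNbr (i - 30)).map (· + 30))

namespace tutteCoxeterDouble

theorem mem_pairs_of_adj {u v : Fin 61} (h : tutteCoxeterDouble.Adj u v) :
    (u.val, v.val) ∈ tutteCoxeterDoublePairs ∨ (v.val, u.val) ∈ tutteCoxeterDoublePairs :=
  ((SimpleGraph.fromRel_adj _ _ _).mp h).2

theorem mem_nbr_of_adj (u v : Fin 61) (h : tutteCoxeterDouble.Adj u v) :
    v.val ∈ tutteCoxeterDoubleNbr u.val := by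
  have key : ∀ q ∈ tutteCoxeterDoublePairs,
      q.2 ∈ tutteCoxeterDoubleNbr q.1 ∧ q.1 ∈ tutteCoxeterDoubleNbr q.2 := by decide +kernel
  rcases mem_pairs_of_adj h with h | h
  · exact (key _ h).1
  · exact (key _ h).2

theorem sort_ne_of_adj (u v : Fin 61) (h : tutteCoxeterDouble.Adj u v) :
    tutteCoxeterDoubleSort u ≠ tutteCoxeterDoubleSort v := by
  have key : ∀ q ∈ tutteCoxeterDoublePairs,
      (if q.1 = 60 then true else decide (q.1 % 2 = 1)) ≠
        (if q.2 = 60 then true else decide (q.2 % 2 = 1)) := by decide +kernel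
  rcases mem_pairs_of_adj h with h | h
  · exact key _ h
  · exact (key _ h).symm

theorem eight_le_egirth : (8 : ℕ∞) ≤ tutteCoxeterDouble.egirth :=
  le_egirth_of_avoidsTarget mem_nbr_of_adj 6 (by decide +kernel)

/-- Away from the vertex `c`, adjacent vertices lie in the same copy. -/
theorem lt_iff_lt_of_adj {u v : Fin 61} (h : tutteCoxeterDouble.Adj u v)
    (hu : u.val ≠ 60) (hv : v.val ≠ 60) : u.val < 30 ↔ v.val < 30 := by
  have key : ∀ q ∈ tutteCoxeterDoublePairs,
      q.1 ≠ 60 → q.2 ≠ 60 → (q.1 < 30 ↔ q.2 < 30) := by decide +kernel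
  rcases mem_pairs_of_adj h with h | h
  · exact key _ h hu hv
  · exact (key _ h hv hu).symm

end tutteCoxeterDouble

theorem tutteCoxeter_card_neighborFinset (i : Fin 30) :
    (Finset.univ.filter (tutteCoxeter.Adj i)).card = 3 := by
  revert i
  decide +kernel

theorem tutteCoxeter_adj_succ (i : Fin 30) : tutteCoxeter.Adj i (i + 1) := by
  revert i
  decide +kernel

/-- The vertex `c` has degree two, so it is not in the image of an embedding. -/
theorem tutteCoxeter_embedding_ne (f : tutteCoxeter ↪g tutteCoxeterDouble) (i : Fin 30) :
    (f i).val ≠ 60 := by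
  intro hi
  have hsub : (Finset.univ.filter (tutteCoxeter.Adj i)).map f.toEmbedding ⊆ {0, 30} := by
    intro v hv
    simp only [Finset.mem_map, Finset.mem_filter, Finset.mem_univ, true_and] at hv
    obtain ⟨j, hj, rfl⟩ := hv
    have h := tutteCoxeterDouble.mem_nbr_of_adj _ _ (f.map_adj_iff.mpr hj)
    rw [hi, tutteCoxeterDoubleNbr, if_pos rfl, List.mem_pair] at h
    rw [Finset.mem_insert, Finset.mem_singleton]
    exact h.imp Fin.ext Fin.ext
  have hcard := Finset.card_le_card hsub
  rw [Finset.card_map, tutteCoxeter_card_neighborFinset] at hcard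
  exact absurd hcard (by decide)

/-- The image of an embedding lies in a single copy. -/
theorem tutteCoxeter_embedding_lt_iff (f : tutteCoxeter ↪g tutteCoxeterDouble) (i : Fin 30) :
    (f i).val < 30 ↔ (f 0).val < 30 := by
  induction i using Fin.induction with
  | zero => rfl
  | succ i ih =>
    rw [← ih, ← Fin.coeSucc_eq_succ]
    exact (tutteCoxeterDouble.lt_iff_lt_of_adj
      (f.map_adj_iff.mpr (tutteCoxeter_adj_succ i.castSucc))
      (tutteCoxeter_embedding_ne f _) (tutteCoxeter_embedding_ne f _)).symm

/-- An injection of `Fin m` into a finite set with at most `m` elements is onto it. -/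
theorem range_eq_coe_of_card_le {m : ℕ} {α : Type*} (f : Fin m ↪ α) (s : Finset α)
    (hf : ∀ i, f i ∈ s) (hs : s.card ≤ m) : Set.range f = (s : Set α) := by
  have h : Finset.univ.map f = s := by
    refine Finset.eq_of_subset_of_card_le ?_ (by simpa using hs)
    intro v hv
    obtain ⟨i, -, rfl⟩ := Finset.mem_map.mp hv
    exact hf i
  rw [← h]
  simp

/-- `B` is bipartite of girth at least 8, and every graph embedding of the
Tutte–Coxeter graph into `B` has image the first copy `A₁ = {0, ..., 29}` or the second
copy `A₂ = {30, ..., 59}`. -/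
theorem tutteCoxeterDouble_properties :
    ((∀ v w, tutteCoxeterDouble.Adj v w → tutteCoxeterDoubleSort v ≠ tutteCoxeterDoubleSort w) ∧
      (8 : ℕ∞) ≤ tutteCoxeterDouble.egirth) ∧
    (∀ f : tutteCoxeter ↪g tutteCoxeterDouble,
      Set.range (f : Fin 30 → Fin 61) = {v : Fin 61 | v.val < 30} ∨
      Set.range (f : Fin 30 → Fin 61) = {v : Fin 61 | 30 ≤ v.val ∧ v.val < 60}) := by
  refine ⟨⟨tutteCoxeterDouble.sort_ne_of_adj, tutteCoxeterDouble.eight_le_egirth⟩, fun f => ?_⟩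
  by_cases h0 : (f 0).val < 30
  · left
    have := range_eq_coe_of_card_le f.toEmbedding (Finset.univ.filter fun v => v.val < 30)
      (fun i => by simpa using (tutteCoxeter_embedding_lt_iff f i).mpr h0) (by decide +kernel)
    simpa using this
  · right
    have := range_eq_coe_of_card_le f.toEmbedding
      (Finset.univ.filter fun v => 30 ≤ v.val ∧ v.val < 60)
      (fun i => by
        have hlt := (tutteCoxeter_embedding_lt_iff f i).not.mpr h0
        have hne := tutteCoxeter_embedding_ne f i
        have hmem : 30 ≤ (f i).val ∧ (f i).val < 60 := by omega
        simpa using hmem)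
      (by decide +kernel)
    simpa using this
end

section
/- Let n = 2m+1 with m ≥ 2, and let A be the configuration consisting of seven chains a_k^1 | ... | a_k^{n−2} (1 ≤ k ≤ 7) joined in sequence by a_k^{n−2} | a_{k+1}^1, four chains b_k^1 | ... | b_k^{n−3} (1 ≤ k ≤ 4) with incidences a_1^1|b_1^1, a_2^1|b_2^1, a_3^1|b_3^1, a_4^1|b_4^1 and a_4^{n−2}|b_1^{n−3}, a_5^{n−2}|b_2^{n−3}, a_6^{n−2}|b_3^{n−3}, a_7^{n−2}|b_4^{n−3}, and a chain c_1 | ... | c_{n−4} with a_1^1|c_1 and a_7^{n−2}|c_{n−4}. Then every cycle in A has length at least 2n, i.e., A is a partial n-gon. -/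
/-- The vertex set of the odd-case configuration `A` (for `n = 2m + 1`, `m ≥ 2`):
seven `a`-chains `a_k^1, ..., a_k^{n-2}` (`1 ≤ k ≤ 7`), four `b`-chains
`b_k^1, ..., b_k^{n-3}` (`1 ≤ k ≤ 4`), and one `c`-chain `c_1, ..., c_{n-4}`.
Indices are shifted down by one, so `a_k^i` is `Sum.inl (k - 1, i - 1)`, etc. -/
abbrev OddConfigV (n : ℕ) : Type :=
  (Fin 7 × Fin (n - 2)) ⊕ ((Fin 4 × Fin (n - 3)) ⊕ Fin (n - 4))

/-- The base incidences of the odd-case configuration: along each chain; the joins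
`a_k^{n-2} | a_{k+1}^1` (`1 ≤ k ≤ 6`); the incidences `a_k^1 | b_k^1` (`1 ≤ k ≤ 4`) and
`a_{k+3}^{n-2} | b_k^{n-3}` (`1 ≤ k ≤ 4`); and `a_1^1 | c_1`, `a_7^{n-2} | c_{n-4}`. -/
def oddConfigRel (n : ℕ) : OddConfigV n → OddConfigV n → Prop
  | .inl (k, i), .inl (k', i') =>
      (k = k' ∧ i'.val = i.val + 1) ∨ (k'.val = k.val + 1 ∧ i.val = n - 3 ∧ i'.val = 0)
  | .inl (k, i), .inr (.inl (k', i')) =>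
      (k.val = k'.val ∧ i.val = 0 ∧ i'.val = 0) ∨
      (k.val = k'.val + 3 ∧ i.val = n - 3 ∧ i'.val = n - 4)
  | .inl (k, i), .inr (.inr j) =>
      (k.val = 0 ∧ i.val = 0 ∧ j.val = 0) ∨ (k.val = 6 ∧ i.val = n - 3 ∧ j.val = n - 5)
  | .inr (.inl (k, i)), .inr (.inl (k', i')) => k = k' ∧ i'.val = i.val + 1
  | .inr (.inr j), .inr (.inr j') => j'.val = j.val + 1
  | _, _ => False

/-- The odd-case configuration `A` of Construction 3.4, as a simple graph. -/
def oddConfig (n : ℕ) : SimpleGraph (OddConfigV n) :=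
  SimpleGraph.fromRel (oddConfigRel n)

/-- `atLeastTwoIfAny p q r` fails exactly when one of `p`, `q`, `r` holds alone. -/
def atLeastTwoIfAny (p q r : Bool) : Bool :=
  !(p || q || r) || (p && q) || (p && r) || (q && r)

theorem atLeastTwoIfAny_decide {p q r v : Prop} [Decidable p] [Decidable q] [Decidable r]
    (hv : p ∨ q ∨ r → v) (h : v → (p ∧ q) ∨ (p ∧ r) ∨ (q ∧ r)) :
    atLeastTwoIfAny (decide p) (decide q) (decide r) := by
  by_cases hp : p <;> by_cases hq : q <;> by_cases hr : r <;> simp_all [atLeastTwoIfAny]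

set_option maxRecDepth 10000 in
/-- In the Möbius ladder on eight vertices (the Wagner graph), a nonempty set of edges
without vertices of degree one has at least four edges and covers at least four vertices. -/
theorem four_le_card_of_wagner (x0 x1 x2 x3 x4 x5 x6 y0 y1 y2 y3 z : Bool) :
    (x0 || x1 || x2 || x3 || x4 || x5 || x6 || y0 || y1 || y2 || y3 || z) →
    atLeastTwoIfAny x0 y0 z → atLeastTwoIfAny x0 x1 y1 → atLeastTwoIfAny x1 x2 y2 →
    atLeastTwoIfAny x2 x3 y3 → atLeastTwoIfAny x3 x4 y0 → atLeastTwoIfAny x4 x5 y1 →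
    atLeastTwoIfAny x5 x6 y2 → atLeastTwoIfAny x6 y3 z →
    4 ≤ x0.toNat + x1.toNat + x2.toNat + x3.toNat + x4.toNat + x5.toNat + x6.toNat +
      y0.toNat + y1.toNat + y2.toNat + y3.toNat + z.toNat ∧
    4 ≤ (x0 || y0 || z).toNat + (x0 || x1 || y1).toNat + (x1 || x2 || y2).toNat +
      (x2 || x3 || y3).toNat + (x3 || x4 || y0).toNat + (x4 || x5 || y1).toNat +
      (x5 || x6 || y2).toNat + (x6 || y3 || z).toNat := by
  revert x0 x1 x2 x3 x4 x5 x6 y0 y1 y2 y3 z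
  decide +kernel

/-- Numerical coordinates of a vertex: the chain it lies on (`0`-`6` for the `a`-chains,
`7`-`10` for the `b`-chains, `11` for the `c`-chain) and its position there. -/
def oddConfigCoord {n : ℕ} : OddConfigV n → ℕ × ℕ
  | .inl (k, i) => (k, i)
  | .inr (.inl (k, i)) => (k + 7, i)
  | .inr (.inr j) => (11, j)

/-- The base incidences in coordinates, with `L = n - 2`. -/
def coordRel (L t i t' i' : ℕ) : Prop :=
  (t = t' ∧ i' = i + 1) ∨ (t < 6 ∧ t' = t + 1 ∧ i + 1 = L ∧ i' = 0) ∨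
  (t ≤ 3 ∧ t' = t + 7 ∧ i = 0 ∧ i' = 0) ∨
  (3 ≤ t ∧ t ≤ 6 ∧ t' = t + 4 ∧ i + 1 = L ∧ i' + 2 = L) ∨
  (t = 0 ∧ t' = 11 ∧ i = 0 ∧ i' = 0) ∨ (t = 6 ∧ t' = 11 ∧ i' + 3 = L ∧ i + 1 = L)

/-- The bounds satisfied by the coordinates of a vertex. -/
def coordBound (L t i : ℕ) : Prop :=
  (t ≤ 6 ∧ i < L) ∨ (7 ≤ t ∧ t ≤ 10 ∧ i + 1 < L) ∨ (t = 11 ∧ i + 2 < L)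

theorem oddConfigCoord_injective (n : ℕ) :
    Function.Injective (oddConfigCoord : OddConfigV n → ℕ × ℕ) := by
  rintro (⟨k, i⟩ | ⟨k, i⟩ | j) (⟨k', i'⟩ | ⟨k', i'⟩ | j') h <;>
    simp only [oddConfigCoord, Prod.mk.injEq] at h <;>
    simp only [Sum.inl.injEq, Sum.inr.injEq, Prod.mk.injEq, Fin.ext_iff, reduceCtorEq] <;> omega

theorem coordBound_oddConfigCoord {n L : ℕ} (hL : n = L + 2) (v : OddConfigV n) :
    coordBound L (oddConfigCoord v).1 (oddConfigCoord v).2 := by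
  rcases v with (⟨⟨k, hk⟩, ⟨i, hi⟩⟩ | ⟨⟨k, hk⟩, ⟨i, hi⟩⟩ | ⟨j, hj⟩) <;>
    simp only [oddConfigCoord, coordBound, true_and] <;> omega

theorem coordRel_of_oddConfigRel {n L : ℕ} (hL : n = L + 2) (hL3 : 3 ≤ L) (v w : OddConfigV n)
    (h : oddConfigRel n v w) : coordRel L (oddConfigCoord v).1 (oddConfigCoord v).2
      (oddConfigCoord w).1 (oddConfigCoord w).2 := by
  rcases v with (⟨⟨k, hk⟩, i⟩ | ⟨⟨k, hk⟩, i⟩ | j) <;>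
    rcases w with (⟨⟨k', hk'⟩, i'⟩ | ⟨⟨k', hk'⟩, i'⟩ | j') <;>
    simp only [oddConfigCoord, coordRel, oddConfigRel, Fin.mk.injEq, true_and] at h ⊢
  · rcases h with h | h
    · exact Or.inl h
    · exact Or.inr (Or.inl (by omega))
  · rcases h with h | h
    · exact Or.inr (Or.inr (Or.inl (by omega)))
    · exact Or.inr (Or.inr (Or.inr (Or.inl (by omega))))
  · rcases h with h | h
    · exact Or.inr (Or.inr (Or.inr (Or.inr (Or.inl (by omega)))))
    · exact Or.inr (Or.inr (Or.inr (Or.inr (Or.inr (by omega)))))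
  · exact Or.inl ⟨by omega, h.2⟩
  · exact Or.inl h

/-- A set of coordinates in which every member has two distinct neighbours. -/
structure IsCoordClosed (L : ℕ) (P : ℕ → ℕ → Prop) : Prop where
  bound : ∀ t i, P t i → coordBound L t i
  two_neighbors : ∀ t i, P t i → ∃ t₁ i₁ t₂ i₂, P t₁ i₁ ∧ P t₂ i₂ ∧ ¬(t₁ = t₂ ∧ i₁ = i₂) ∧
    (coordRel L t i t₁ i₁ ∨ coordRel L t₁ i₁ t i) ∧ (coordRel L t i t₂ i₂ ∨ coordRel L t₂ i₂ t i)

namespace IsCoordClosed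

variable {L : ℕ} {P : ℕ → ℕ → Prop}

/-- If all neighbours of a member are among two vertices, both are members. -/
theorem both (h : IsCoordClosed L P) {t i p q r s : ℕ} (hP : P t i)
    (hn : ∀ t' i', coordBound L t' i' → (coordRel L t i t' i' ∨ coordRel L t' i' t i) →
      (t' = p ∧ i' = q) ∨ (t' = r ∧ i' = s)) : P p q ∧ P r s := by
  obtain ⟨t₁, i₁, t₂, i₂, h₁, h₂, hne, r₁, r₂⟩ := h.two_neighbors t i hP
  have b₁ := hn _ _ (h.bound _ _ h₁) r₁
  have b₂ := hn _ _ (h.bound _ _ h₂) r₂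
  grind

/-- If all neighbours of a member are among three vertices, two of these are members. -/
theorem two_of_three (h : IsCoordClosed L P) {t i p q r s u v : ℕ} (hP : P t i)
    (hn : ∀ t' i', coordBound L t' i' → (coordRel L t i t' i' ∨ coordRel L t' i' t i) →
      (t' = p ∧ i' = q) ∨ (t' = r ∧ i' = s) ∨ (t' = u ∧ i' = v)) :
    (P p q ∧ P r s) ∨ (P p q ∧ P u v) ∨ (P r s ∧ P u v) := by
  obtain ⟨t₁, i₁, t₂, i₂, h₁, h₂, hne, r₁, r₂⟩ := h.two_neighbors t i hP
  have b₁ := hn _ _ (h.bound _ _ h₁) r₁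
  have b₂ := hn _ _ (h.bound _ _ h₂) r₂
  grind

theorem a_interior (h : IsCoordClosed L P) {k i : ℕ} (hk : k ≤ 6) (h0 : 0 < i) (h1 : i + 1 < L)
    (hP : P k i) : P k (i - 1) ∧ P k (i + 1) :=
  h.both hP fun t' i' => by simp only [coordBound, coordRel]; omega

theorem b_down (h : IsCoordClosed L P) {k i : ℕ} (hk : k ≤ 3)
    (hP : P (k + 7) (i + 1)) : P (k + 7) i := by
  have hb := h.bound _ _ hP
  simp only [coordBound] at hb
  by_cases hi : i + 3 < L
  · exact (h.both (p := k + 7) (q := i) (r := k + 7) (s := i + 2) hP fun t' i' => by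
      simp only [coordBound, coordRel]; omega).1
  · exact (h.both (p := k + 7) (q := i) (r := k + 3) (s := L - 1) hP fun t' i' => by
      simp only [coordBound, coordRel]; omega).1

theorem b_up (h : IsCoordClosed L P) {k i : ℕ} (hk : k ≤ 3) (hi : i + 2 < L)
    (hP : P (k + 7) i) : P (k + 7) (i + 1) := by
  rcases i with _ | i
  · exact (h.both (p := k) (q := 0) (r := k + 7) (s := 1) hP fun t' i' => by
      simp only [coordBound, coordRel]; omega).2
  · exact (h.both (p := k + 7) (q := i) (r := k + 7) (s := i + 2) hP fun t' i' => by
      simp only [coordBound, coordRel]; omega).2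

theorem b_first (h : IsCoordClosed L P) {k : ℕ} (hk : k ≤ 3) (hL : 3 ≤ L)
    (hP : P (k + 7) 0) : P k 0 :=
  (h.both (p := k) (q := 0) (r := k + 7) (s := 1) hP fun t' i' => by
    simp only [coordBound, coordRel]; omega).1

theorem b_last (h : IsCoordClosed L P) {k : ℕ} (hk : k ≤ 3) (hL : 3 ≤ L)
    (hP : P (k + 7) (L - 2)) : P (k + 3) (L - 1) :=
  (h.both (p := k + 3) (q := L - 1) (r := k + 7) (s := L - 3) hP fun t' i' => by
    simp only [coordBound, coordRel]; omega).1

theorem c_down (h : IsCoordClosed L P) {i : ℕ} (hP : P 11 (i + 1)) : P 11 i := by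
  have hb := h.bound _ _ hP
  simp only [coordBound] at hb
  by_cases hi : i + 4 < L
  · exact (h.both (p := 11) (q := i) (r := 11) (s := i + 2) hP fun t' i' => by
      simp only [coordBound, coordRel]; omega).1
  · exact (h.both (p := 11) (q := i) (r := 6) (s := L - 1) hP fun t' i' => by
      simp only [coordBound, coordRel]; omega).1

theorem c_up (h : IsCoordClosed L P) {i : ℕ} (hi : i + 3 < L) (hP : P 11 i) : P 11 (i + 1) := by
  rcases i with _ | i
  · exact (h.both (p := 0) (q := 0) (r := 11) (s := 1) hP fun t' i' => by
      simp only [coordBound, coordRel]; omega).2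
  · exact (h.both (p := 11) (q := i) (r := 11) (s := i + 2) hP fun t' i' => by
      simp only [coordBound, coordRel]; omega).2

theorem c_first (h : IsCoordClosed L P) (hP : P 11 0) : P 0 0 := by
  by_cases h3 : L = 3
  · exact (h.both (p := 0) (q := 0) (r := 6) (s := L - 1) hP fun t' i' => by
      simp only [coordBound, coordRel]; omega).1
  · exact (h.both (p := 0) (q := 0) (r := 11) (s := 1) hP fun t' i' => by
      simp only [coordBound, coordRel]; omega).1

theorem c_last (h : IsCoordClosed L P) (hL : 3 ≤ L) (hP : P 11 (L - 3)) : P 6 (L - 1) := by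
  by_cases h3 : L = 3
  · exact (h.both (p := 0) (q := 0) (r := 6) (s := L - 1) hP fun t' i' => by
      simp only [coordBound, coordRel]; omega).2
  · exact (h.both (p := 11) (q := L - 4) (r := 6) (s := L - 1) hP fun t' i' => by
      simp only [coordBound, coordRel]; omega).2

theorem a_to_one (h : IsCoordClosed L P) {k i : ℕ} (hk : k ≤ 6) (h1 : i + 2 < L)
    (hP : P k (i + 1)) : P k 1 := by
  induction i with
  | zero => exact hP
  | succ i ih => exact ih (by omega) (h.a_interior hk (by omega) (by omega) hP).1

theorem a_all (h : IsCoordClosed L P) {k i : ℕ} (hk : k ≤ 6) (hL : 3 ≤ L)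
    (hP : P k 1) (hi : i < L) : P k i := by
  induction i using Nat.strong_induction_on with
  | _ i ih =>
    rcases i with _ | _ | i
    · exact (h.a_interior hk (by omega) (by omega) hP).1
    · exact hP
    · exact (h.a_interior hk (by omega) (by omega) (ih (i + 1) (by omega) (by omega))).2

theorem b_to_zero (h : IsCoordClosed L P) {k i : ℕ} (hk : k ≤ 3)
    (hP : P (k + 7) i) : P (k + 7) 0 := by
  induction i with
  | zero => exact hP
  | succ i ih => exact ih (h.b_down hk hP)

theorem b_all (h : IsCoordClosed L P) {k i : ℕ} (hk : k ≤ 3)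
    (hP : P (k + 7) 0) (hi : i + 1 < L) : P (k + 7) i := by
  induction i with
  | zero => exact hP
  | succ i ih => exact h.b_up hk (by omega) (ih (by omega))

theorem c_to_zero (h : IsCoordClosed L P) {i : ℕ} (hP : P 11 i) : P 11 0 := by
  induction i with
  | zero => exact hP
  | succ i ih => exact ih (h.c_down hP)

theorem c_all (h : IsCoordClosed L P) {i : ℕ} (hP : P 11 0) (hi : i + 2 < L) : P 11 i := by
  induction i with
  | zero => exact hP
  | succ i ih => exact h.c_up (by omega) (ih (by omega))

theorem a_last_to_one (h : IsCoordClosed L P) {k : ℕ} (hk : k ≤ 2) (hL : 3 ≤ L)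
    (hP : P k (L - 1)) : P k 1 ∧ P (k + 1) 0 := by
  have h2 := h.both (p := k) (q := L - 3 + 1) (r := k + 1) (s := 0) hP fun t' i' => by
    simp only [coordBound, coordRel]; omega
  exact ⟨h.a_to_one (by omega) (by omega) h2.1, h2.2⟩

theorem a_first_to_one (h : IsCoordClosed L P) {k : ℕ} (hk : 3 ≤ k) (hk' : k ≤ 5) (hL : 3 ≤ L)
    (hP : P (k + 1) 0) : P (k + 1) 1 ∧ P k (L - 1) :=
  h.both hP fun t' i' => by simp only [coordBound, coordRel]; omega

theorem first_zero (h : IsCoordClosed L P) (hL : 3 ≤ L) (hP : P 0 0) :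
    (P 0 1 ∧ P 7 0) ∨ (P 0 1 ∧ P 11 0) ∨ (P 7 0 ∧ P 11 0) :=
  h.two_of_three hP fun t' i' => by simp only [coordBound, coordRel]; omega

theorem first_succ (h : IsCoordClosed L P) {k : ℕ} (hk : k ≤ 2) (hL : 3 ≤ L) (hP : P (k + 1) 0) :
    (P k 1 ∧ P (k + 1) 1) ∨ (P k 1 ∧ P (k + 8) 0) ∨ (P (k + 1) 1 ∧ P (k + 8) 0) := by
  have h2 := h.two_of_three (p := k) (q := L - 1) (r := k + 1) (s := 1) (u := k + 8) (v := 0) hP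
    fun t' i' => by simp only [coordBound, coordRel]; omega
  have h3 := h.a_last_to_one hk hL
  tauto

theorem last_three (h : IsCoordClosed L P) {k : ℕ} (hk : k ≤ 2) (hL : 3 ≤ L)
    (hP : P (k + 3) (L - 1)) :
    (P (k + 3) 1 ∧ P (k + 4) 1) ∨ (P (k + 3) 1 ∧ P (k + 7) 0) ∨
      (P (k + 4) 1 ∧ P (k + 7) 0) := by
  have h2 := h.two_of_three (p := k + 3) (q := L - 3 + 1) (r := k + 4) (s := 0) (u := k + 7)
    (v := L - 2) hP fun t' i' => by simp only [coordBound, coordRel]; omega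
  have h3 := h.a_first_to_one (k := k + 3) (by omega) (by omega) hL
  have h4 := h.a_to_one (k := k + 3) (i := L - 3) (by omega) (by omega)
  have h5 := h.b_to_zero (k := k) (i := L - 2) (by omega)
  tauto

theorem last_six (h : IsCoordClosed L P) (hL : 3 ≤ L) (hP : P 6 (L - 1)) :
    (P 6 1 ∧ P 10 0) ∨ (P 6 1 ∧ P 11 0) ∨ (P 10 0 ∧ P 11 0) := by
  have h2 := h.two_of_three (p := 6) (q := L - 3 + 1) (r := 10) (s := L - 2) (u := 11)
    (v := L - 3) hP fun t' i' => by simp only [coordBound, coordRel]; omega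
  have h4 := h.a_to_one (k := 6) (i := L - 3) (by omega) (by omega)
  have h5 := h.b_to_zero (k := 3) (i := L - 2) (by omega)
  have h6 := h.c_to_zero (i := L - 3)
  tauto

theorem exists_chain (h : IsCoordClosed L P) (hL : 3 ≤ L) {t i : ℕ} (hP : P t i) :
    P 0 1 ∨ P 1 1 ∨ P 2 1 ∨ P 3 1 ∨ P 4 1 ∨ P 5 1 ∨ P 6 1 ∨ P 7 0 ∨ P 8 0 ∨ P 9 0 ∨
      P 10 0 ∨ P 11 0 := by
  rcases h.bound t i hP with ⟨ht, hi⟩ | ⟨ht, ht', hi⟩ | ⟨rfl, hi⟩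
  · have ha : P t 1 ∨ P t 0 ∨ P t (L - 1) := by
      by_cases h0 : i = 0
      · exact .inr (.inl (h0 ▸ hP))
      · by_cases h1 : i = L - 1
        · exact .inr (.inr (h1 ▸ hP))
        · obtain ⟨j, rfl⟩ : ∃ j, i = j + 1 := ⟨i - 1, by omega⟩
          exact .inl (h.a_to_one ht (by omega) hP)
    rcases ha with ha | ha | ha
    · interval_cases t <;> simp only [ha, true_or, or_true]
    · have := h.first_zero hL
      have := h.first_succ (k := t - 1)
      have := h.a_first_to_one (k := t - 1)
      interval_cases t <;> grind
    · have := h.a_last_to_one (k := t)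
      have := h.last_three (k := t - 3)
      have := h.last_six hL
      interval_cases t <;> grind
  · obtain ⟨k, rfl⟩ : ∃ k, t = k + 7 := ⟨t - 7, by omega⟩
    have := h.b_to_zero (by omega) hP
    have hk : k ≤ 3 := by omega
    interval_cases k <;> simp_all
  · simp [h.c_to_zero hP]

end IsCoordClosed

section Counting

open Classical in
/-- Indicator of a numerical predicate on coordinates. -/
noncomputable def coordIndicator (P : ℕ → ℕ → Prop) (t i : ℕ) : ℕ := (decide (P t i)).toNat

variable {P : ℕ → ℕ → Prop}

theorem coordIndicator_of (t i : ℕ) (h : P t i) : coordIndicator P t i = 1 := by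
  simp [coordIndicator, h]

theorem coordIndicator_of_not (t i : ℕ) (h : ¬P t i) : coordIndicator P t i = 0 := by
  simp [coordIndicator, h]

theorem mul_le_sum_coordIndicator (m s t j : ℕ) (h : P t j → ∀ i < m, P t (i + s)) :
    m * coordIndicator P t j ≤ ∑ i : Fin m, coordIndicator P t (i + s) := by
  by_cases hP : P t j
  · rw [Finset.sum_congr rfl fun (i : Fin m) _ => coordIndicator_of t (i + s) (h hP i i.isLt)]
    simp [coordIndicator_of t j hP]
  · simp [coordIndicator_of_not t j hP]

theorem toNat_or_le_coordIndicator {p q r : Prop} [Decidable p] [Decidable q] [Decidable r]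
    {t i : ℕ} (h : p ∨ q ∨ r → P t i) :
    (decide p || decide q || decide r).toNat ≤ coordIndicator P t i := by
  by_cases hv : P t i
  · exact (Bool.toNat_le _).trans (coordIndicator_of t i hv).ge
  · simp_all

theorem coordIndicator_le {t i t' i' : ℕ} (h : P t i → P t' i') :
    coordIndicator P t i ≤ coordIndicator P t' i' := by
  by_cases hP : P t i
  · exact ((coordIndicator_of t i hP).trans (coordIndicator_of t' i' (h hP)).symm).le
  · simp [coordIndicator_of_not t i hP]

end Counting

theorem IsCoordClosed.le_sum_coordIndicator {l : ℕ} {P : ℕ → ℕ → Prop}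
    (h : IsCoordClosed (l + 3) P) (t₀ i₀ : ℕ) (h₀ : P t₀ i₀) :
    2 * (l + 5) ≤ ∑ v : OddConfigV (l + 5),
      coordIndicator P (oddConfigCoord v).1 (oddConfigCoord v).2 := by
  classical
  have hL : 3 ≤ l + 3 := by omega
  have ha (k : Fin 7) : coordIndicator P k 0 + (l + 1) * coordIndicator P k 1 +
      coordIndicator P k (l + 2) ≤ ∑ i : Fin (l + 3), coordIndicator P k i := by
    rw [Fin.sum_univ_succ, Fin.sum_univ_castSucc]
    have := mul_le_sum_coordIndicator (P := P) (l + 1) 1 k 1 fun h1 i hi =>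
      h.a_all (by omega) hL h1 (by omega)
    simp only [Fin.val_zero, Fin.val_succ, Fin.val_castSucc, Fin.val_last]
    change _ ≤ _ + (_ + coordIndicator P k (l + 2))
    omega
  have hb (k : Fin 4) : (l + 2) * coordIndicator P (k + 7) 0 ≤
      ∑ i : Fin (l + 2), coordIndicator P (k + 7) i :=
    mul_le_sum_coordIndicator (P := P) (l + 2) 0 (k + 7) 0 fun h1 i hi =>
      h.b_all (by omega) h1 (by omega)
  have hc : (l + 1) * coordIndicator P 11 0 ≤ ∑ i : Fin (l + 1), coordIndicator P 11 i :=
    mul_le_sum_coordIndicator (P := P) (l + 1) 0 11 0 fun h1 i hi => h.c_all h1 (by omega)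
  have hsum := add_le_add (Finset.sum_le_sum fun k (_ : k ∈ Finset.univ) => ha k)
    (add_le_add (Finset.sum_le_sum fun k (_ : k ∈ Finset.univ) => hb k) hc)
  have hS : ∑ v : OddConfigV (l + 5), coordIndicator P (oddConfigCoord v).1 (oddConfigCoord v).2 =
      ∑ k : Fin 7, ∑ i : Fin (l + 3), coordIndicator P k i +
      (∑ k : Fin 4, ∑ i : Fin (l + 2), coordIndicator P (k + 7) i +
        ∑ i : Fin (l + 1), coordIndicator P 11 i) := by
    rw [Fintype.sum_sum_type, Fintype.sum_sum_type, Fintype.sum_prod_type, Fintype.sum_prod_type]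
    rfl
  rw [hS]
  refine le_trans ?_ hsum
  have xf (k : ℕ) (hk : k ≤ 6) (hx : P k 1) : P k 0 := h.a_all hk hL hx (by omega)
  have xl (k : ℕ) (hk : k ≤ 6) (hx : P k 1) : P k (l + 2) := h.a_all hk hL hx (by omega)
  have xn (k : ℕ) (hk : k ≤ 2) (hx : P k 1) : P (k + 1) 0 :=
    (h.a_last_to_one hk hL (xl k (by omega) hx)).2
  have xp (k : ℕ) (hk : 3 ≤ k) (hk' : k ≤ 5) (hx : P (k + 1) 1) : P k (l + 2) :=
    (h.a_first_to_one hk hk' hL (xf (k + 1) (by omega) hx)).2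
  have yl (k : ℕ) (hk : k ≤ 3) (hy : P (k + 7) 0) : P (k + 3) (l + 2) :=
    h.b_last hk hL (h.b_all hk hy (by omega))
  have v0 : P 0 1 ∨ P 7 0 ∨ P 11 0 → P 0 0 :=
    fun hv => hv.elim (xf 0 (by omega)) (·.elim (h.b_first (k := 0) (by omega) hL) (h.c_first))
  have vs (k : ℕ) (hk : k ≤ 2) : P k 1 ∨ P (k + 1) 1 ∨ P (k + 8) 0 → P (k + 1) 0 :=
    fun hv => hv.elim (xn k hk) (·.elim (xf (k + 1) (by omega))
      (h.b_first (k := k + 1) (by omega) hL))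
  have we (k : ℕ) (hk : k ≤ 2) : P (k + 3) 1 ∨ P (k + 4) 1 ∨ P (k + 7) 0 → P (k + 3) (l + 2) :=
    fun hv => hv.elim (xl (k + 3) (by omega)) (·.elim (xp (k + 3) (by omega) (by omega))
      (yl k (by omega)))
  have w6 : P 6 1 ∨ P 10 0 ∨ P 11 0 → P 6 (l + 2) :=
    fun hv => hv.elim (xl 6 (by omega)) (·.elim (yl 3 (by omega))
      fun hz => h.c_last hL (h.c_all hz (by omega)))
  have hw := four_le_card_of_wagner (decide (P 0 1)) (decide (P 1 1)) (decide (P 2 1))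
    (decide (P 3 1)) (decide (P 4 1)) (decide (P 5 1)) (decide (P 6 1)) (decide (P 7 0))
    (decide (P 8 0)) (decide (P 9 0)) (decide (P 10 0)) (decide (P 11 0))
    (by simpa [or_assoc] using h.exists_chain hL h₀)
    (atLeastTwoIfAny_decide v0 (h.first_zero hL))
    (atLeastTwoIfAny_decide (vs 0 (by omega)) (h.first_succ (k := 0) (by omega) hL))
    (atLeastTwoIfAny_decide (vs 1 (by omega)) (h.first_succ (k := 1) (by omega) hL))
    (atLeastTwoIfAny_decide (vs 2 (by omega)) (h.first_succ (k := 2) (by omega) hL))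
    (atLeastTwoIfAny_decide (we 0 (by omega)) (h.last_three (k := 0) (by omega) hL))
    (atLeastTwoIfAny_decide (we 1 (by omega)) (h.last_three (k := 1) (by omega) hL))
    (atLeastTwoIfAny_decide (we 2 (by omega)) (h.last_three (k := 2) (by omega) hL))
    (atLeastTwoIfAny_decide w6 (h.last_six hL))
  have g0 := toNat_or_le_coordIndicator v0
  have g1 := toNat_or_le_coordIndicator (vs 0 (by omega))
  have g2 := toNat_or_le_coordIndicator (vs 1 (by omega))
  have g3 := toNat_or_le_coordIndicator (vs 2 (by omega))
  have d0 := toNat_or_le_coordIndicator (we 0 (by omega))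
  have d1 := toNat_or_le_coordIndicator (we 1 (by omega))
  have d2 := toNat_or_le_coordIndicator (we 2 (by omega))
  have d3 := toNat_or_le_coordIndicator w6
  have m0 := coordIndicator_le (xl 0 (by omega))
  have m1 := coordIndicator_le (xl 1 (by omega))
  have m2 := coordIndicator_le (xl 2 (by omega))
  have m4 := coordIndicator_le (xf 4 (by omega))
  have m5 := coordIndicator_le (xf 5 (by omega))
  have m6 := coordIndicator_le (xf 6 (by omega))
  have b3 : coordIndicator P 3 1 ≤ 1 := Bool.toNat_le _
  have b11 : coordIndicator P 11 0 ≤ 1 := Bool.toNat_le _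
  obtain ⟨hE, hV⟩ := hw
  have hind (t i : ℕ) : (decide (P t i)).toNat = coordIndicator P t i := rfl
  simp only [hind] at hE
  have hmul := Nat.mul_le_mul_left l hE
  simp only [Fin.sum_univ_seven, Fin.sum_univ_four]
  simp only [Fin.isValue, Fin.coe_ofNat_eq_mod, Nat.reduceMod, Nat.reduceAdd, zero_add]
    at g0 g1 g2 g3 d0 d1 d2 d3 m0 m1 m2 m4 m5 m6 ⊢
  simp only [add_mul, mul_add, one_mul] at hmul ⊢
  omega

theorem oddConfig_isCoordClosed {l : ℕ} {v : OddConfigV (l + 5)}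
    {c : (oddConfig (l + 5)).Walk v v} (hc : c.IsCycle) :
    IsCoordClosed (l + 3) fun t i => ∃ w ∈ c.support, oddConfigCoord w = (t, i) where
  bound := by
    rintro t i ⟨w, -, hw⟩
    have := coordBound_oddConfigCoord (L := l + 3) rfl w
    rwa [hw] at this
  two_neighbors := by
    rintro t i ⟨w, hwc, hw⟩
    have h2 := hc.ncard_neighborSet_toSubgraph_eq_two hwc
    obtain ⟨x, y, hxy, hN⟩ := Set.ncard_eq_two.mp h2
    have key : ∀ u, u ∈ c.toSubgraph.neighborSet w → u ∈ c.support ∧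
        (coordRel (l + 3) t i (oddConfigCoord u).1 (oddConfigCoord u).2 ∨
          coordRel (l + 3) (oddConfigCoord u).1 (oddConfigCoord u).2 t i) := by
      intro u hu
      refine ⟨c.mem_verts_toSubgraph.mp (c.toSubgraph.edge_vert hu.symm), ?_⟩
      have hadj := ((SimpleGraph.fromRel_adj _ _ _).mp hu.adj_sub).2
      have := hadj.imp (coordRel_of_oddConfigRel (L := l + 3) rfl (by omega) w u)
        (coordRel_of_oddConfigRel (L := l + 3) rfl (by omega) u w)
      simpa only [hw] using this
    have kx := key x (hN ▸ by simp)
    have ky := key y (hN ▸ by simp)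
    exact ⟨_, _, _, _, ⟨x, kx.1, rfl⟩, ⟨y, ky.1, rfl⟩,
      fun h => hxy (oddConfigCoord_injective _ (Prod.ext h.1 h.2)), kx.2, ky.2⟩

theorem oddConfig_cycle_length {l : ℕ} {v : OddConfigV (l + 5)}
    {c : (oddConfig (l + 5)).Walk v v} (hc : c.IsCycle) : 2 * (l + 5) ≤ c.length := by
  refine ((oddConfig_isCoordClosed hc).le_sum_coordIndicator _ _
    ⟨v, c.start_mem_support, rfl⟩).trans ?_
  have hsub : ∑ w : OddConfigV (l + 5), coordIndicator
      (fun t i => ∃ w ∈ c.support, oddConfigCoord w = (t, i))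
      (oddConfigCoord w).1 (oddConfigCoord w).2 = c.support.tail.toFinset.card := by
    rw [Finset.card_eq_sum_ones, ← Finset.sum_subset (Finset.subset_univ _)]
    · refine Finset.sum_congr rfl fun w hw => coordIndicator_of _ _ ⟨w, ?_, rfl⟩
      exact List.mem_of_mem_tail (List.mem_toFinset.mp hw)
    · refine fun w _ hw => coordIndicator_of_not _ _ ?_
      rintro ⟨u, hu, huw⟩
      obtain rfl := oddConfigCoord_injective _ huw
      refine hw (List.mem_toFinset.mpr ?_)
      rcases (SimpleGraph.Walk.mem_support_iff c).mp hu with rfl | hu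
      · exact c.end_mem_tail_support hc.not_nil
      · exact hu
  rw [hsub]
  exact (List.toFinset_card_le _).trans (by simp)

/-- for `n = 2m + 1` with `m ≥ 2`, every cycle in the odd-case
configuration `A` has length at least `2n`; i.e., `A` is a partial `n`-gon
(its girth is at least `2n`). -/
theorem oddConfig_cycles_long (n m : ℕ) (hm : 2 ≤ m) (hn : n = 2 * m + 1) :
    (∀ (v : OddConfigV n) (c : (oddConfig n).Walk v v), c.IsCycle → 2 * n ≤ c.length) ∧
    (2 * n : ℕ∞) ≤ (oddConfig n).egirth := by
  obtain ⟨l, rfl⟩ : ∃ l, n = l + 5 := ⟨n - 5, by omega⟩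
  refine ⟨fun v c hc => oddConfig_cycle_length hc, ?_⟩
  rw [SimpleGraph.le_egirth]
  intro v c hc
  exact_mod_cast oddConfig_cycle_length hc
end

section
/- Let (W, S) be a Coxeter system whose Coxeter diagram has no rank-3 spherical residues, i.e., for all distinct i, j, k ∈ S we have 1/m_{ij} + 1/m_{ik} + 1/m_{jk} ≤ 1 (with 1/∞ = 0). Then for every w ∈ W of length n+1, the chamber w is adjacent in the Coxeter complex to at most two chambers of length ≤ n; equivalently, there exist at most two s ∈ S with ℓ(ws) = ℓ(w) − 1... unless this would force a finite rank-3 standard parabolic subgroup. -/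
namespace CoxeterMatrix

variable {B : Type*} (M : CoxeterMatrix B)

/-- The linear form `x ↦ ⟨αᵢ, x⟩` of the geometric representation, where
`⟨αᵢ, αⱼ⟩ = -cos (π / M i j)` (which is `-1` when `M i j = 0`, encoding `∞`). -/
noncomputable def rootForm (i : B) : (B →₀ ℝ) →ₗ[ℝ] ℝ :=
  Finsupp.linearCombination ℝ fun j => -Real.cos (Real.pi / M i j)

/-- The simple root `αᵢ`. -/
noncomputable def simpleRoot (_ : CoxeterMatrix B) (i : B) : B →₀ ℝ := Finsupp.single i 1

/-- The reflection `x ↦ x - 2 ⟨αᵢ, x⟩ αᵢ`. -/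
noncomputable def rootReflection (i : B) : Module.End ℝ (B →₀ ℝ) :=
  LinearMap.id - (2 : ℝ) • (M.rootForm i).smulRight (M.simpleRoot i)

theorem rootForm_simpleRoot (i j : B) :
    M.rootForm i (M.simpleRoot j) = -Real.cos (Real.pi / M i j) := by
  simp [rootForm, simpleRoot]

theorem rootForm_simpleRoot_self (i : B) : M.rootForm i (M.simpleRoot i) = 1 := by
  simp [rootForm_simpleRoot]

theorem rootReflection_apply (i : B) (x : B →₀ ℝ) :
    M.rootReflection i x = x - (2 * M.rootForm i x) • M.simpleRoot i := by
  simp [rootReflection, smul_smul]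

theorem simpleRoot_nonneg (i : B) : 0 ≤ M.simpleRoot i :=
  Finsupp.single_nonneg.2 zero_le_one

theorem rootReflection_simpleRoot_self (i : B) :
    M.rootReflection i (M.simpleRoot i) = -M.simpleRoot i := by
  rw [rootReflection_apply, rootForm_simpleRoot_self]
  module

theorem rootReflection_mul_self (i : B) : M.rootReflection i * M.rootReflection i = 1 := by
  ext1 x
  ext1
  simp only [LinearMap.comp_apply, Module.End.mul_apply, Module.End.one_apply]
  rw [rootReflection_apply M i (Finsupp.lsingle x 1), map_sub, map_smul,
    rootReflection_simpleRoot_self, rootReflection_apply]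
  module

theorem rootReflection_smul_add_smul (i j : B) (a b : ℝ) :
    M.rootReflection j (a • M.simpleRoot i + b • M.simpleRoot j) =
      a • M.simpleRoot i + (2 * Real.cos (Real.pi / M i j) * a - b) • M.simpleRoot j := by
  rw [rootReflection_apply, map_add, map_smul, map_smul, rootForm_simpleRoot_self,
    rootForm_simpleRoot, M.symmetric j i]
  simp only [smul_eq_mul]
  module

theorem two_le_of_ne_of_ne_zero {i j : B} (hij : i ≠ j) (hM : M i j ≠ 0) : 2 ≤ M i j := by
  have := M.off_diagonal i j hij
  omega

theorem pi_div_nonneg (i j : B) : 0 ≤ Real.pi / M i j := by positivity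

theorem pi_div_le_pi_div_two {i j : B} (hij : i ≠ j) : Real.pi / M i j ≤ Real.pi / 2 := by
  by_cases hM : M i j = 0
  · simpa [hM] using Real.pi_div_two_pos.le
  · have : (2 : ℝ) ≤ M i j := by exact_mod_cast M.two_le_of_ne_of_ne_zero hij hM
    gcongr

theorem cos_pi_div_nonneg {i j : B} (hij : i ≠ j) : 0 ≤ Real.cos (Real.pi / M i j) :=
  Real.cos_nonneg_of_mem_Icc
    ⟨by linarith [M.pi_div_nonneg i j, Real.pi_pos], M.pi_div_le_pi_div_two hij⟩

theorem rootForm_simpleRoot_nonpos {i j : B} (hij : i ≠ j) :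
    M.rootForm i (M.simpleRoot j) ≤ 0 := by
  rw [rootForm_simpleRoot]
  linarith [M.cos_pi_div_nonneg hij]

theorem sin_pi_div_pos {i j : B} (hij : i ≠ j) (hM : M i j ≠ 0) :
    0 < Real.sin (Real.pi / M i j) := by
  apply Real.sin_pos_of_pos_of_lt_pi
  · have : (0 : ℝ) < M i j := by positivity
    positivity
  · linarith [M.pi_div_le_pi_div_two hij, Real.pi_pos]

theorem rootReflection_mul_pow_apply_sin (i j : B) (φ : ℝ) (n : ℕ) :
    ((M.rootReflection i * M.rootReflection j) ^ n)
      (Real.sin (φ + Real.pi / M i j) • M.simpleRoot i + Real.sin φ • M.simpleRoot j) =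
    Real.sin (φ + n * (2 * (Real.pi / M i j)) + Real.pi / M i j) • M.simpleRoot i +
      Real.sin (φ + n * (2 * (Real.pi / M i j))) • M.simpleRoot j := by
  induction n generalizing φ with
  | zero => simp
  | succ n ih =>
    have key : ∀ ψ θ : ℝ, 2 * Real.cos θ * Real.sin (ψ + θ) - Real.sin ψ =
        Real.sin (ψ + 2 * θ) := by
      intro ψ θ
      rw [two_mul θ, ← add_assoc, Real.sin_add (ψ + θ) θ]
      have : Real.sin ψ = Real.sin (ψ + θ - θ) := by ring_nf
      rw [this, Real.sin_sub]
      ring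
    have step : (M.rootReflection i * M.rootReflection j)
        (Real.sin (φ + Real.pi / M i j) • M.simpleRoot i + Real.sin φ • M.simpleRoot j) =
        Real.sin (φ + 2 * (Real.pi / M i j) + Real.pi / M i j) • M.simpleRoot i +
          Real.sin (φ + 2 * (Real.pi / M i j)) • M.simpleRoot j := by
      rw [Module.End.mul_apply, rootReflection_smul_add_smul, key, add_comm,
        rootReflection_smul_add_smul, M.symmetric j i, add_comm]
      congr 2
      have := key (φ + Real.pi / M i j) (Real.pi / M i j)
      rw [show φ + Real.pi / M i j + Real.pi / M i j = φ + 2 * (Real.pi / M i j) by ring] at this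
      rw [this]
      ring_nf
    rw [pow_succ, Module.End.mul_apply, step, ih]
    push_cast
    congr 3 <;> ring

theorem rootReflection_isLiftable : M.IsLiftable M.rootReflection := by
  intro i j
  rcases eq_or_ne i j with rfl | hij
  · simp [rootReflection_mul_self]
  by_cases hM : M i j = 0
  · simp [hM]
  have hsin := (M.sin_pi_div_pos hij hM).ne'
  set T := (M.rootReflection i * M.rootReflection j) ^ M i j with hT
  have period (φ : ℝ) :
      T (Real.sin (φ + Real.pi / M i j) • M.simpleRoot i + Real.sin φ • M.simpleRoot j) =
        Real.sin (φ + Real.pi / M i j) • M.simpleRoot i + Real.sin φ • M.simpleRoot j := by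
    rw [hT, rootReflection_mul_pow_apply_sin]
    have : φ + M i j * (2 * (Real.pi / M i j)) = φ + 2 * Real.pi := by
      have : (M i j : ℝ) ≠ 0 := by exact_mod_cast hM
      field_simp
    rw [this, add_right_comm, Real.sin_add_two_pi, Real.sin_add_two_pi]
  have hi : T (M.simpleRoot i) = M.simpleRoot i := by
    simpa [hsin] using period 0
  have hj : T (M.simpleRoot j) = M.simpleRoot j := by
    simpa [hsin] using period (-(Real.pi / M i j))
  have hperp (y : B →₀ ℝ) (hyi : M.rootForm i y = 0) (hyj : M.rootForm j y = 0) : T y = y := by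
    have fixed : (M.rootReflection i * M.rootReflection j) y = y := by
      simp [rootReflection_apply, hyi, hyj]
    rw [hT, Module.End.pow_apply]
    exact Function.iterate_fixed fixed _
  refine LinearMap.ext fun x => ?_
  rw [Module.End.one_apply]
  set c := Real.cos (Real.pi / M i j) with hc
  set d := Real.sin (Real.pi / M i j) with hd
  have hcd : 1 - c ^ 2 = d ^ 2 := by rw [hc, hd, Real.sin_sq]
  obtain ⟨a, b, ha, hb⟩ : ∃ a b : ℝ, M.rootForm i x = a - c * b ∧
      M.rootForm j x = b - c * a := by
    refine ⟨(M.rootForm i x + c * M.rootForm j x) / d ^ 2,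
      (M.rootForm j x + c * M.rootForm i x) / d ^ 2, ?_, ?_⟩ <;>
    · field_simp
      rw [← hcd]
      ring
  have hy := hperp (x - a • M.simpleRoot i - b • M.simpleRoot j)
    (by simp [rootForm_simpleRoot, ← hc, ha]; ring)
    (by simp [rootForm_simpleRoot, M.symmetric j i, ← hc, hb]; ring)
  rw [map_sub, map_sub, map_smul, map_smul, hi, hj] at hy
  simpa using hy

/-- The coefficients `u` of the positive roots of a rank-two parabolic subgroup, up to scaling. -/
theorem exists_dihedral_coefficients {i j : B} (hij : i ≠ j) :
    ∃ u : ℕ → ℝ, u 0 = 0 ∧ 0 < u 1 ∧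
      (∀ n, u (n + 2) = 2 * Real.cos (Real.pi / M i j) * u (n + 1) - u n) ∧
      ∀ n, (M i j ≠ 0 → n ≤ M i j) → 0 ≤ u n := by
  by_cases hM : M i j = 0
  · refine ⟨fun n => n, by simp, by simp, fun n => ?_, fun n _ => by positivity⟩
    simp only [hM]
    push_cast
    simp
    ring
  · refine ⟨fun n => Real.sin (n * (Real.pi / M i j)), by simp,
      by simpa using M.sin_pi_div_pos hij hM, fun n => ?_, fun n hn => ?_⟩
    · push_cast
      set θ := Real.pi / M i j
      rw [show ((n : ℝ) + 2) * θ = (n + 1) * θ + θ by ring,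
        show (n : ℝ) * θ = (n + 1) * θ - θ by ring, Real.sin_add, Real.sin_sub]
      ring
    · apply Real.sin_nonneg_of_nonneg_of_le_pi (by positivity)
      have h0 : (0 : ℝ) < M i j := by positivity
      have h1 : (n : ℝ) ≤ M i j := by exact_mod_cast hn hM
      rw [mul_div_assoc', div_le_iff₀ h0, mul_comm]
      gcongr

/-- If three simple reflections do not generate a finite group, then some nonzero nonnegative
combination of their roots pairs nonpositively with every simple root. -/
theorem exists_rootForm_nonpos {i j k : B} (hij : i ≠ j) (hik : i ≠ k) (hjk : j ≠ k)
    (h : ((M i j : ℝ))⁻¹ + ((M i k : ℝ))⁻¹ + ((M j k : ℝ))⁻¹ ≤ 1) :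
    ∃ x y z : ℝ, 0 ≤ x ∧ 0 ≤ y ∧ 0 ≤ z ∧
      x • M.simpleRoot i + y • M.simpleRoot j + z • M.simpleRoot k ≠ 0 ∧
      ∀ l, M.rootForm l
        (x • M.simpleRoot i + y • M.simpleRoot j + z • M.simpleRoot k) ≤ 0 := by
  suffices H : ∃ x y z : ℝ, 0 ≤ x ∧ 0 ≤ y ∧ 0 ≤ z ∧ (x ≠ 0 ∨ y ≠ 0) ∧
      x ≤ Real.cos (Real.pi / M i j) * y + Real.cos (Real.pi / M i k) * z ∧
      y ≤ Real.cos (Real.pi / M i j) * x + Real.cos (Real.pi / M j k) * z ∧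
      z ≤ Real.cos (Real.pi / M i k) * x + Real.cos (Real.pi / M j k) * y by
    obtain ⟨x, y, z, hx, hy, hz, hne, h1, h2, h3⟩ := H
    refine ⟨x, y, z, hx, hy, hz, fun h0 => ?_, fun l => ?_⟩
    · have hi := DFunLike.congr_fun h0 i
      have hj := DFunLike.congr_fun h0 j
      simp [simpleRoot, hij, hij.symm, hik.symm, hjk.symm] at hi hj
      tauto
    · simp only [map_add, map_smul, smul_eq_mul]
      rcases eq_or_ne l i with rfl | hli
      · simp only [rootForm_simpleRoot_self, rootForm_simpleRoot]
        linarith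
      rcases eq_or_ne l j with rfl | hlj
      · simp only [rootForm_simpleRoot_self, rootForm_simpleRoot, M.symmetric l i]
        linarith
      rcases eq_or_ne l k with rfl | hlk
      · simp only [rootForm_simpleRoot_self, rootForm_simpleRoot, M.symmetric l i,
          M.symmetric l j]
        linarith
      nlinarith [mul_nonneg hx (neg_nonneg.2 (M.rootForm_simpleRoot_nonpos hli)),
        mul_nonneg hy (neg_nonneg.2 (M.rootForm_simpleRoot_nonpos hlj)),
        mul_nonneg hz (neg_nonneg.2 (M.rootForm_simpleRoot_nonpos hlk))]
  have hsum : Real.pi / M i j + Real.pi / M i k + Real.pi / M j k ≤ Real.pi := by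
    have := mul_le_mul_of_nonneg_left h Real.pi_pos.le
    simp only [div_eq_mul_inv]
    linarith
  have hA := M.cos_pi_div_nonneg hij
  have hα := M.pi_div_nonneg i j
  have hβ := M.pi_div_nonneg i k
  have hγ := M.pi_div_nonneg j k
  have hβ' := M.pi_div_le_pi_div_two hik
  have hγ' := M.pi_div_le_pi_div_two hjk
  have hpi := Real.pi_pos
  generalize Real.pi / (M i j : ℝ) = α at *
  generalize Real.pi / (M i k : ℝ) = β at *
  generalize Real.pi / (M j k : ℝ) = γ at *
  by_cases h0 : β = 0 ∧ γ = 0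
  · obtain ⟨rfl, rfl⟩ := h0
    exact ⟨1, 1, 1, by simp, by simp, by simp, by simp, by simpa, by simpa, by simp⟩
  have hsβ : 0 ≤ Real.sin β := Real.sin_nonneg_of_nonneg_of_le_pi hβ (by linarith)
  have hsγ : 0 ≤ Real.sin γ := Real.sin_nonneg_of_nonneg_of_le_pi hγ (by linarith)
  have hcos : -Real.cos (β + γ) ≤ Real.cos α := by
    rw [← Real.cos_pi_sub]
    exact Real.cos_le_cos_of_nonneg_of_le_pi hα (by linarith) (by linarith)
  have hβeq : Real.sin β = Real.sin (β + γ) * Real.cos γ - Real.cos (β + γ) * Real.sin γ := by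
    rw [← Real.sin_sub, add_sub_cancel_right]
  have hγeq : Real.sin γ = Real.sin (β + γ) * Real.cos β - Real.cos (β + γ) * Real.sin β := by
    rw [← Real.sin_sub, add_sub_cancel_left]
  refine ⟨Real.sin γ, Real.sin β, Real.sin (β + γ), hsγ, hsβ,
    Real.sin_nonneg_of_nonneg_of_le_pi (by linarith) (by linarith), ?_, ?_, ?_, ?_⟩
  · by_contra! hs
    refine h0 ⟨?_, ?_⟩
    · exact (Real.sin_eq_zero_iff_of_lt_of_lt (by linarith) (by linarith)).1 hs.2
    · exact (Real.sin_eq_zero_iff_of_lt_of_lt (by linarith) (by linarith)).1 hs.1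
  · linarith [mul_le_mul_of_nonneg_right hcos hsβ]
  · linarith [mul_le_mul_of_nonneg_right hcos hsγ]
  · rw [Real.sin_add]
    linarith

end CoxeterMatrix

namespace CoxeterSystem

variable {B W : Type*} [Group W] {M : CoxeterMatrix B} (cs : CoxeterSystem M W)

/-- The geometric (Tits) representation of a Coxeter group. -/
noncomputable def geometricRep : W →* Module.End ℝ (B →₀ ℝ) :=
  cs.lift ⟨M.rootReflection, M.rootReflection_isLiftable⟩

theorem geometricRep_simple (i : B) : cs.geometricRep (cs.simple i) = M.rootReflection i :=
  cs.lift_apply_simple M.rootReflection_isLiftable i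

theorem geometricRep_alternatingWord {i j : B} {u : ℕ → ℝ}
    (hu : ∀ n, u (n + 2) = 2 * Real.cos (Real.pi / M i j) * u (n + 1) - u n) (k n : ℕ) :
    ∃ a b, (a = i ∧ b = j ∨ a = j ∧ b = i) ∧
      cs.geometricRep (cs.wordProd (alternatingWord i j k))
        (u (n + 1) • M.simpleRoot i + u n • M.simpleRoot j) =
      u (n + k + 1) • M.simpleRoot a + u (n + k) • M.simpleRoot b := by
  induction k generalizing i j n with
  | zero => exact ⟨i, j, by simp, by simp [alternatingWord]⟩
  | succ k ih =>
    obtain ⟨a, b, hab, h⟩ := ih (i := j) (j := i) (by rwa [M.symmetric j i]) (n + 1)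
    refine ⟨a, b, hab.symm, ?_⟩
    rw [alternatingWord_succ, wordProd_concat, map_mul, Module.End.mul_apply,
      geometricRep_simple, M.rootReflection_smul_add_smul, ← hu, add_comm, h]
    congr 3 <;> ring

/-- An element `w` with a descent `j` is the product of an element without descent at `i` or `j`
and a word alternating between `i` and `j`, with additive lengths. -/
theorem exists_eq_mul_alternatingWord {w : W} {i j : B}
    (hj : cs.length (w * cs.simple j) < cs.length w) :
    ∃ v k, w = v * cs.wordProd (alternatingWord i j k) ∧ cs.length w = cs.length v + k ∧
      cs.length v < cs.length w ∧ cs.length v < cs.length (v * cs.simple i) ∧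
      cs.length v < cs.length (v * cs.simple j) := by
  let P (n : ℕ) : Prop := ∃ v k, cs.length v = n ∧ 0 < k ∧
    w = v * cs.wordProd (alternatingWord i j k) ∧ cs.length w = cs.length v + k
  have hP : ∃ n, P n := by
    refine ⟨_, w * cs.simple j, 1, rfl, one_pos, by simp [alternatingWord], ?_⟩
    have := cs.length_mul_simple w j
    omega
  classical
  obtain ⟨v, k, hv, hk, hw, hl⟩ := Nat.find_spec hP
  have hmin : ∀ v' k', 0 < k' → w = v' * cs.wordProd (alternatingWord i j k') →
      cs.length w = cs.length v' + k' → cs.length v ≤ cs.length v' := by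
    intro v' k' h1 h2 h3
    rw [hv]
    exact Nat.find_min' hP ⟨v', k', rfl, h1, h2, h3⟩
  have hnext : cs.length v < cs.length (v * cs.simple (if Even k then j else i)) := by
    by_contra! hle
    have hlen := cs.length_mul_simple v (if Even k then j else i)
    have := hmin (v * cs.simple (if Even k then j else i)) (k + 1) (by omega)
      (by rw [alternatingWord_succ', wordProd_cons, mul_assoc, simple_mul_simple_cancel_left, hw])
      (by omega)
    omega
  have hprev : cs.length v < cs.length (v * cs.simple (if Even k then i else j)) := by
    by_contra! hle
    have hlen := cs.length_mul_simple v (if Even k then i else j)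
    obtain ⟨k, rfl⟩ : ∃ k', k = k' + 1 := ⟨k - 1, by omega⟩
    have hif : (if Even (k + 1) then i else j) = if Even k then j else i := by
      by_cases he : Even k <;> simp [he, Nat.even_add_one]
    rw [hif] at hlen hle
    rw [alternatingWord_succ', wordProd_cons, ← mul_assoc] at hw
    have h1 := cs.length_mul_le (v * cs.simple (if Even k then j else i))
      (cs.wordProd (alternatingWord i j k))
    have h2 := cs.length_wordProd_le (alternatingWord i j k)
    rw [length_alternatingWord] at h2
    rw [← hw] at h1
    omega
  refine ⟨v, k, hw, hl, by omega, ?_, ?_⟩ <;> by_cases he : Even k <;> simp_all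

theorem geometricRep_simpleRoot_nonneg (w : W) (i : B)
    (hi : cs.length w < cs.length (w * cs.simple i)) :
    0 ≤ cs.geometricRep w (M.simpleRoot i) := by
  induction hn : cs.length w using Nat.strong_induction_on generalizing w i with
  | _ n ih =>
    subst hn
    by_cases hw1 : w = 1
    · simpa [hw1] using M.simpleRoot_nonneg i
    obtain ⟨j, hj⟩ := cs.exists_rightDescent_of_ne_one hw1
    have hij : i ≠ j := by
      rintro rfl
      exact hi.not_gt hj
    obtain ⟨v, k, hw, hl, hlt, hvi, hvj⟩ := cs.exists_eq_mul_alternatingWord (i := i) hj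
    have hpi := ih _ hlt v i hvi rfl
    have hpj := ih _ hlt v j hvj rfl
    have hk : M i j ≠ 0 → k + 1 ≤ M i j := by
      intro hM
      by_contra! hlt'
      rw [M.symmetric i j] at hM hlt'
      apply cs.not_isReduced_alternatingWord j i hM hlt'
      have h1 : w * cs.simple i = v * cs.wordProd (alternatingWord j i (k + 1)) := by
        rw [alternatingWord_succ, wordProd_concat, ← mul_assoc, ← hw]
      have h2 := cs.length_mul_le v (cs.wordProd (alternatingWord j i (k + 1)))
      have h3 := cs.length_wordProd_le (alternatingWord j i (k + 1))
      rw [← h1] at h2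
      unfold IsReduced
      rw [length_alternatingWord] at h3 ⊢
      omega
    obtain ⟨u, hu0, hu1, hu, hnonneg⟩ := M.exists_dihedral_coefficients hij
    obtain ⟨a, b, hab, h⟩ := cs.geometricRep_alternatingWord hu k 0
    have hpa : 0 ≤ cs.geometricRep v (M.simpleRoot a) := by
      rcases hab with ⟨rfl, rfl⟩ | ⟨rfl, rfl⟩ <;> assumption
    have hpb : 0 ≤ cs.geometricRep v (M.simpleRoot b) := by
      rcases hab with ⟨rfl, rfl⟩ | ⟨rfl, rfl⟩ <;> assumption
    have key : u 1 • cs.geometricRep w (M.simpleRoot i) =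
        u (k + 1) • cs.geometricRep v (M.simpleRoot a) +
          u k • cs.geometricRep v (M.simpleRoot b) := by
      rw [hu0, zero_smul, add_zero, map_smul, zero_add, zero_add] at h
      rw [hw, map_mul, Module.End.mul_apply, ← map_smul, h, map_add, map_smul, map_smul]
    have hnn : 0 ≤ u 1 • cs.geometricRep w (M.simpleRoot i) := by
      rw [key]
      exact add_nonneg (smul_nonneg (hnonneg _ hk) hpa)
        (smul_nonneg (hnonneg _ fun hM => by have := hk hM; omega) hpb)
    exact (smul_nonneg_iff_nonneg_of_pos_left hu1).1 hnn

theorem geometricRep_simpleRoot_nonpos (w : W) (i : B)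
    (hi : cs.length (w * cs.simple i) < cs.length w) :
    cs.geometricRep w (M.simpleRoot i) ≤ 0 := by
  have h := cs.geometricRep_simpleRoot_nonneg (w * cs.simple i) i (by simpa using hi)
  rw [map_mul, Module.End.mul_apply, geometricRep_simple, M.rootReflection_simpleRoot_self,
    map_neg] at h
  exact neg_nonneg.1 h

theorem le_geometricRep_of_rootForm_nonpos {x : B →₀ ℝ} (hx : ∀ l, M.rootForm l x ≤ 0)
    (w : W) : x ≤ cs.geometricRep w x := by
  induction hn : cs.length w using Nat.strong_induction_on generalizing w with
  | _ n ih =>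
    subst hn
    by_cases hw1 : w = 1
    · simp [hw1]
    obtain ⟨j, hj⟩ := cs.exists_rightDescent_of_ne_one hw1
    have h1 := ih _ hj _ rfl
    have h2 := cs.geometricRep_simpleRoot_nonneg (w * cs.simple j) j
      (by rwa [cs.simple_mul_simple_cancel_right])
    have h3 : cs.geometricRep w x = cs.geometricRep (w * cs.simple j) x +
        (-(2 * M.rootForm j x)) • cs.geometricRep (w * cs.simple j) (M.simpleRoot j) := by
      conv_lhs => rw [← cs.simple_mul_simple_cancel_right (w := w) j]
      rw [map_mul, Module.End.mul_apply, geometricRep_simple, M.rootReflection_apply, map_sub,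
        map_smul]
      module
    rw [h3]
    exact le_add_of_le_of_nonneg h1 (smul_nonneg (by linarith [hx j]) h2)

end CoxeterSystem


/-- let `(W, S)` be a Coxeter system whose Coxeter diagram has no rank-3
spherical residues, i.e. for all pairwise distinct `i, j, k` we have
`1/m i j + 1/m i k + 1/m j k ≤ 1` (where, following the Mathlib convention, `m i j = 0`
encodes `m i j = ∞`, and correspondingly `(0 : ℝ)⁻¹ = 0` encodes `1/∞ = 0`). Then every
`w ∈ W` has at most two right descents: there are at most two simple reflections `s` with
`ℓ(ws) < ℓ(w)`; equivalently, every chamber of the Coxeter complex of length `n + 1` is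
adjacent to at most two chambers of length `≤ n`. -/
theorem at_most_two_descents_of_no_spherical_rank_three {B : Type} {W : Type} [Group W]
    {M : CoxeterMatrix B} (cs : CoxeterSystem M W)
    (h : ∀ i j k : B, i ≠ j → i ≠ k → j ≠ k →
      ((M i j : ℝ))⁻¹ + ((M i k : ℝ))⁻¹ + ((M j k : ℝ))⁻¹ ≤ 1) :
    ∀ w : W, {i : B | cs.length (w * cs.simple i) < cs.length w}.encard ≤ 2 := by
  intro w
  by_contra! hlt
  obtain ⟨t, ht, hcard⟩ := Set.exists_subset_encard_eq (Order.add_one_le_of_lt hlt)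
  obtain ⟨i, j, k, hij, hik, hjk, rfl⟩ := Set.encard_eq_three.1 (hcard.trans (by norm_num))
  have hi := cs.geometricRep_simpleRoot_nonpos w i (ht (by simp))
  have hj := cs.geometricRep_simpleRoot_nonpos w j (ht (by simp))
  have hk := cs.geometricRep_simpleRoot_nonpos w k (ht (by simp))
  obtain ⟨x, y, z, hx, hy, hz, hne, hform⟩ :=
    M.exists_rootForm_nonpos hij hik hjk (h i j k hij hik hjk)
  refine hne (le_antisymm ((cs.le_geometricRep_of_rootForm_nonpos hform w).trans ?_) ?_)
  · simp only [map_add, map_smul]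
    exact add_nonpos (add_nonpos (smul_nonpos_of_nonneg_of_nonpos hx hi)
      (smul_nonpos_of_nonneg_of_nonpos hy hj)) (smul_nonpos_of_nonneg_of_nonpos hz hk)
  · exact add_nonneg (add_nonneg (smul_nonneg hx (M.simpleRoot_nonneg i))
      (smul_nonneg hy (M.simpleRoot_nonneg j))) (smul_nonneg hz (M.simpleRoot_nonneg k))
end
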